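/- arXiv:2209.10946 — 4 statements merged into one kernel-verified Lean document; each statement's English description precedes it below -/
import Mathlib

section
/- Let σ > 0 and μ ∈ ℝ; set ς = e^{σ²} and, for j ∈ ℕ, ν_j = e^{j²σ²/2 − jμ}. For an integer l ≥ 0, let A_l be the (l+1)×(l+1) Hankel matrix with entries (A_l)_{ij} = ν_{i+j} for 0 ≤ i, j ≤ l. Then det A_l = e^{−l(l+1)μ} · ς^{l(l+1)(2l+1)/6} · ∏_{0 ≤ j < i ≤ l} (ς^i − ς^j). -/
/-- The Vandermonde determinant of the first `n` terms of a sequence, as a product over the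
natural numbers `j < i < n`. -/
theorem Matrix.det_vandermonde_eq_prod_range {R : Type*} [CommRing R] (n : ℕ) (v : ℕ → R) :
    (Matrix.vandermonde fun i : Fin n => v i).det =
      ∏ i ∈ Finset.range n, ∏ j ∈ Finset.range i, (v i - v j) := by
  rw [Matrix.det_vandermonde, Finset.prod_range,
    Finset.prod_comm' (t' := Finset.univ) (s' := fun j => Finset.Iio j) (by simp)]
  refine Finset.prod_congr rfl fun i _ => ?_
  rw [← Nat.Iio_eq_range, ← Fin.map_valEmbedding_Iio, Finset.prod_map]
  rfl

/-- A Hankel matrix whose entries factor as `a (i + j) = a i * a j * q ^ (i * j)` is a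
two-sided diagonal rescaling of the Vandermonde matrix in the powers of `q`. -/
theorem Matrix.det_hankel_of_apply_add {R : Type*} [CommRing R] (n : ℕ) (a : ℕ → R) (q : R)
    (h : ∀ i j, a (i + j) = a i * a j * q ^ (i * j)) :
    (Matrix.of fun i j : Fin n => a (i + j)).det =
      (∏ i ∈ Finset.range n, a i) ^ 2 *
        ∏ i ∈ Finset.range n, ∏ j ∈ Finset.range i, (q ^ i - q ^ j) := by
  have hM : (Matrix.of fun i j : Fin n => a (i + j)) =
      Matrix.of fun i j : Fin n => a i * (Matrix.of fun i j : Fin n =>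
        a j * Matrix.vandermonde (fun i : Fin n => q ^ (i : ℕ)) i j) i j := by
    ext i j
    simp only [Matrix.of_apply, Matrix.vandermonde_apply, h, pow_mul, mul_assoc]
  rw [hM, Matrix.det_mul_column, Matrix.det_mul_row,
    Matrix.det_vandermonde_eq_prod_range n fun i => q ^ i, Finset.prod_range a, sq, mul_assoc]

theorem Real.sq_prod_exp_quadratic (s μ : ℝ) (l : ℕ) :
    (∏ i ∈ Finset.range (l + 1), Real.exp ((i : ℝ) ^ 2 * s / 2 - i * μ)) ^ 2 =
      Real.exp (-((l : ℝ) * (l + 1)) * μ + s * ((l : ℝ) * (l + 1) * (2 * l + 1) / 6)) := by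
  induction l with
  | zero => simp
  | succ l ih =>
    rw [Finset.prod_range_succ, mul_pow, ih, ← Real.exp_nat_mul, ← Real.exp_add]
    congr 1
    push_cast
    ring

/-- Hankel determinant evaluation `U_l` of Appendix G: for the Lognormal inverse moments
`ν j = exp(j²σ²/2 − jμ)` and `ς = exp σ²`, the determinant of the Hankel matrix
`(ν (i+j))` of size `(l+1)` equals
`exp(−l(l+1)μ) ς^{l(l+1)(2l+1)/6} ∏_{0 ≤ j < i ≤ l} (ς^i − ς^j)`. -/
theorem stmt_10 (σ μ : ℝ) (hσ : 0 < σ) (l : ℕ)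
    (ς : ℝ) (hς : ς = Real.exp (σ ^ 2))
    (ν : ℕ → ℝ) (hν : ∀ j : ℕ, ν j = Real.exp ((j : ℝ) ^ 2 * σ ^ 2 / 2 - j * μ)) :
    (Matrix.of fun i j : Fin (l + 1) => ν ((i : ℕ) + (j : ℕ))).det
      = Real.exp (-((l : ℝ) * (l + 1)) * μ) *
          ς ^ (((l : ℝ) * (l + 1) * (2 * l + 1)) / 6) *
          ∏ i ∈ Finset.range (l + 1), ∏ j ∈ Finset.range i, (ς ^ i - ς ^ j) := by
  have h_add : ∀ i j, ν (i + j) = ν i * ν j * ς ^ (i * j) := by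
    intro i j
    rw [hν, hν, hν, hς, ← Real.exp_nat_mul, ← Real.exp_add, ← Real.exp_add]
    congr 1
    push_cast
    ring
  rw [Matrix.det_hankel_of_apply_add _ _ _ h_add]
  simp only [hν]
  rw [Real.sq_prod_exp_quadratic, Real.exp_add, Real.exp_mul (σ ^ 2), ← hς]
end

section
/- Let σ > 0 and μ ∈ ℝ; set ς = e^{σ²} and ν_j = e^{j²σ²/2 − jμ} for j ∈ ℕ. For integers 0 ≤ k ≤ l, let A_l be the (l+1)×(l+1) Hankel matrix with entries ν_{i+j} (0 ≤ i, j ≤ l), let U_l = det A_l, and let U_l^{l,k} denote the determinant of the l×l matrix obtained from A_l by deleting its last row (row index l) and its column of index k. Then U_l^{l,k} = U_l / ((−1)^{l−k} ν_l ν_k ∏_{t=0, t≠k}^{l} (ς^k − ς^t)). -/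
/-- Splitting off the row of index `k` from a Vandermonde determinant. -/
theorem det_vandermonde_eq_mul_succAbove {R : Type*} [CommRing R] {n : ℕ}
    (v : Fin (n + 1) → R) (k : Fin (n + 1)) :
    (Matrix.vandermonde v).det =
      (-1) ^ (n - (k : ℕ)) * (∏ j, (v k - v (k.succAbove j))) *
        (Matrix.vandermonde (v ∘ k.succAbove)).det := by
  have hperm := Matrix.det_permute k.cycleRange.symm (Matrix.vandermonde v)
  have hcycle : (Matrix.vandermonde v).submatrix k.cycleRange.symm id =
      Matrix.vandermonde (v ∘ k.cycleRange.symm) := rfl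
  have hsplit : (Matrix.vandermonde (v ∘ k.cycleRange.symm)).det =
      (∏ j, (v (k.succAbove j) - v k)) * (Matrix.vandermonde (v ∘ k.succAbove)).det := by
    simp [Matrix.det_vandermonde, Fin.prod_univ_succ, Fin.prod_Ioi_succ]
  have hneg : ∏ j, (v (k.succAbove j) - v k) =
      (-1) ^ n * ∏ j, (v k - v (k.succAbove j)) := by
    simp_rw [← neg_sub (v k)]
    rw [Finset.prod_neg, Finset.card_univ, Fintype.card_fin]
  rw [hcycle, hsplit, hneg, Equiv.Perm.sign_symm, Fin.sign_cycleRange] at hperm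
  push_cast at hperm
  have hk : n = (n - (k : ℕ)) + k := by have := k.is_lt; omega
  have hsq : ((-1 : R) ^ (k : ℕ)) * (-1) ^ (k : ℕ) = 1 := by
    rw [← mul_pow]; simp
  have hpow : (-1 : R) ^ n = (-1) ^ (n - (k : ℕ)) * (-1) ^ (k : ℕ) := by
    rw [← pow_add, ← hk]
  rw [hpow] at hperm
  linear_combination (-(-1 : R) ^ (k : ℕ)) * hperm -
    ((Matrix.vandermonde v).det - (-1) ^ (n - (k : ℕ)) * (∏ j, (v k - v (k.succAbove j))) *
        (Matrix.vandermonde (v ∘ k.succAbove)).det) * hsq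

/-- A Vandermonde matrix with rescaled rows and columns, indexed by exponents and then nodes. -/
theorem det_of_mul_mul_pow {R : Type*} [CommRing R] {n : ℕ} (a b v : Fin n → R) :
    (Matrix.of fun i j : Fin n => a i * b j * v j ^ (i : ℕ)).det =
      (∏ i, a i) * (∏ j, b j) * (Matrix.vandermonde v).det := by
  rw [← Matrix.det_transpose (Matrix.vandermonde v), mul_assoc, ← Matrix.det_mul_row,
    ← Matrix.det_mul_column]
  congr 1
  ext i j
  simp [Matrix.vandermonde_apply, mul_assoc]

/-- Equation (80) of Appendix G (Vandermonde minor identity): with `ν j = exp(j²σ²/2 − jμ)`,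
`ς = exp σ²`, `A_l` the Hankel matrix `(ν (i+j))` of size `l+1` and `U_l = det A_l`, the
minor obtained by deleting the last row and column `k` satisfies
`U_l^{l,k} = U_l / ((−1)^{l−k} ν_l ν_k ∏_{t ≠ k} (ς^k − ς^t))`. -/
theorem stmt_12 (σ μ : ℝ) (hσ : 0 < σ) (l k : ℕ) (hk : k ≤ l)
    (ς : ℝ) (hς : ς = Real.exp (σ ^ 2))
    (ν : ℕ → ℝ) (hν : ∀ j : ℕ, ν j = Real.exp ((j : ℝ) ^ 2 * σ ^ 2 / 2 - j * μ))
    (A : Matrix (Fin (l + 1)) (Fin (l + 1)) ℝ)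
    (hA : A = Matrix.of fun i j : Fin (l + 1) => ν ((i : ℕ) + (j : ℕ))) :
    (A.submatrix (Fin.castSucc : Fin l → Fin (l + 1))
        (Fin.succAbove (⟨k, Nat.lt_succ_of_le hk⟩ : Fin (l + 1)))).det
      = A.det / ((-1) ^ (l - k) * ν l * ν k *
          ∏ t ∈ (Finset.range (l + 1)).erase k, (ς ^ k - ς ^ t)) := by
  have hν_add (i j : ℕ) : ν (i + j) = ν i * ν j * (ς ^ j) ^ i := by
    simp only [hν, hς, ← Real.exp_nat_mul, ← Real.exp_add]
    congr 1
    push_cast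
    ring
  have hν_ne (j : ℕ) : ν j ≠ 0 := by rw [hν]; exact Real.exp_ne_zero _
  have hς_one : 1 < ς := by rw [hς]; exact Real.one_lt_exp_iff.mpr (by positivity)
  have hprod_ne : ∏ t ∈ (Finset.range (l + 1)).erase k, (ς ^ k - ς ^ t) ≠ 0 :=
    Finset.prod_ne_zero_iff.mpr fun t ht => sub_ne_zero.mpr fun h =>
      Finset.ne_of_mem_erase ht (pow_right_injective₀ (by positivity) hς_one.ne' h).symm
  set κ : Fin (l + 1) := ⟨k, Nat.lt_succ_of_le hk⟩ with hκ
  have hprod : ∏ t ∈ (Finset.range (l + 1)).erase k, (ς ^ k - ς ^ t) =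
      ∏ j, (ς ^ (κ : ℕ) - ς ^ (κ.succAbove j : ℕ)) := by
    symm
    refine Finset.prod_bij (fun j _ => (κ.succAbove j : ℕ)) (fun j _ => ?_) (fun i _ j _ h => ?_)
      (fun t ht => ?_) (fun _ _ => rfl)
    · rw [Finset.mem_erase, Finset.mem_range]
      exact ⟨fun h => κ.succAbove_ne j (Fin.ext h), Fin.is_lt _⟩
    · exact Fin.succAbove_right_injective (Fin.ext h)
    · rw [Finset.mem_erase, Finset.mem_range] at ht
      obtain ⟨j, hj⟩ := Fin.exists_succAbove_eq (y := κ) (x := ⟨t, ht.2⟩)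
        fun h => ht.1 (congrArg Fin.val h)
      exact ⟨j, Finset.mem_univ _, congrArg Fin.val hj⟩
  have hdet : A.det = (∏ i : Fin (l + 1), ν i) * (∏ i : Fin (l + 1), ν i) *
      (Matrix.vandermonde fun j : Fin (l + 1) => ς ^ (j : ℕ)).det := by
    rw [← det_of_mul_mul_pow, hA]
    simp only [hν_add]
  have hminor : (A.submatrix Fin.castSucc κ.succAbove).det =
      (∏ i : Fin l, ν i) * (∏ j : Fin l, ν (κ.succAbove j)) *
        (Matrix.vandermonde ((fun j : Fin (l + 1) => ς ^ (j : ℕ)) ∘ κ.succAbove)).det := by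
    rw [← det_of_mul_mul_pow, hA]
    congr 1
    ext i j
    simp [hν_add]
  rw [eq_div_iff (mul_ne_zero (mul_ne_zero (mul_ne_zero (by simp) (hν_ne l)) (hν_ne k)) hprod_ne),
    hminor, hdet, det_vandermonde_eq_mul_succAbove _ κ, hprod]
  nth_rewrite 1 [Fin.prod_univ_castSucc]
  rw [Fin.prod_univ_succAbove (fun i : Fin (l + 1) => ν i) κ]
  simp only [Fin.val_castSucc, Fin.val_last, hκ]
  ring
end

section
/- Let N ∈ ℕ and let ν : ℕ → ℝ with ν_0 = 1 be such that for every 0 ≤ l ≤ N the (l+1)×(l+1) Hankel matrix A_l with entries (A_l)_{ij} = ν_{i+j} (0 ≤ i, j ≤ l) is positive definite. Let α : ℕ → ℝ with α_0 = 1 and write α^{(l)} = (α_0, …, α_l)ᵀ ∈ ℝ^{l+1}. For 1 ≤ l ≤ N set v_{l−1} = (ν_l, ν_{l+1}, …, ν_{2l−1})ᵀ ∈ ℝ^l and d_l = ν_{2l} − v_{l−1}ᵀ A_{l−1}^{−1} v_{l−1}. Then d_l > 0 for each such l, and, defining c_0 = (1) ∈ ℝ^1 and c_l = d_l^{−1/2}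 · (−(A_{l−1}^{−1} v_{l−1})ᵀ, 1)ᵀ ∈ ℝ^{l+1} and η_l = c_lᵀ α^{(l)}, one has A_N^{−1} α^{(N)} = ∑_{l=0}^N η_l ĉ_l, where ĉ_l ∈ ℝ^{N+1} is the vector c_l extended by N−l zero coordinates at the end. -/
open Matrix

namespace Matrix

variable {n : ℕ} (M : Matrix (Fin (n + 1)) (Fin (n + 1)) ℝ)

/-- The leading principal block of a matrix indexed by `Fin (n + 1)`. -/
def leadingBlock : Matrix (Fin n) (Fin n) ℝ :=
  M.submatrix Fin.castSucc Fin.castSucc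

/-- The last column of a matrix indexed by `Fin (n + 1)`, without its last entry. -/
def lastColInit : Fin n → ℝ := fun i => M i.castSucc (Fin.last n)

/-- The Schur complement of the leading principal block (for a symmetric matrix). -/
noncomputable def lastSchur : ℝ :=
  M (Fin.last n) (Fin.last n) - M.lastColInit ⬝ᵥ (M.leadingBlock⁻¹ *ᵥ M.lastColInit)

/-- The vector with last entry `1` that `M` maps to a multiple of the last basis vector. -/
noncomputable def lastConj : Fin (n + 1) → ℝ :=
  Fin.snoc (-(M.leadingBlock⁻¹ *ᵥ M.lastColInit)) 1

variable {M}

theorem mulVec_snoc (hM : M.IsSymm) (x : Fin n → ℝ) (t : ℝ) :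
    M *ᵥ (Fin.snoc x t : Fin (n + 1) → ℝ) =
      (Fin.snoc (M.leadingBlock *ᵥ x + t • M.lastColInit)
        (M.lastColInit ⬝ᵥ x + M (Fin.last n) (Fin.last n) * t) : Fin (n + 1) → ℝ) := by
  ext i
  refine Fin.lastCases ?_ (fun i => ?_) i
  · simp [mulVec, dotProduct, Fin.sum_univ_castSucc, lastColInit, hM.apply]
  · simp [mulVec, dotProduct, Fin.sum_univ_castSucc, lastColInit, leadingBlock, mul_comm]

theorem mulVec_lastConj (hM : M.IsSymm) (hB : IsUnit M.leadingBlock.det) :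
    M *ᵥ M.lastConj = (Fin.snoc 0 M.lastSchur : Fin (n + 1) → ℝ) := by
  rw [lastConj, mulVec_snoc hM, mulVec_neg, mulVec_mulVec, mul_nonsing_inv _ hB]
  simp [lastSchur, neg_add_eq_sub]

theorem PosDef.isSymm_real (hM : M.PosDef) : M.IsSymm := by
  simpa [IsHermitian, IsSymm] using hM.isHermitian

theorem PosDef.posDef_leadingBlock (hM : M.PosDef) : M.leadingBlock.PosDef :=
  hM.submatrix (Fin.castSucc_injective n)

theorem PosDef.lastSchur_pos (hM : M.PosDef) : 0 < M.lastSchur := by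
  have h := hM.dotProduct_mulVec_pos (x := M.lastConj) fun h => by
    simpa [lastConj] using congrFun h (Fin.last n)
  rw [mulVec_lastConj hM.isSymm_real hM.posDef_leadingBlock.det_pos.ne'.isUnit] at h
  simpa [dotProduct, Fin.sum_univ_castSucc, lastConj] using h

/-- Rank-one update formula for the inverse of a bordered positive definite matrix. -/
theorem PosDef.inv_mulVec_eq (hM : M.PosDef) (a : Fin (n + 1) → ℝ) :
    M⁻¹ *ᵥ a = (Fin.snoc (M.leadingBlock⁻¹ *ᵥ Fin.init a) 0 : Fin (n + 1) → ℝ) +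
      (M.lastSchur⁻¹ * (M.lastConj ⬝ᵥ a)) • M.lastConj := by
  have hB := hM.posDef_leadingBlock.det_pos.ne'.isUnit
  have hs := hM.lastSchur_pos.ne'
  have hsymm : M.leadingBlock⁻¹ᵀ = M.leadingBlock⁻¹ := by
    rw [transpose_nonsing_inv, leadingBlock, transpose_submatrix, hM.isSymm_real.eq]
  have key : M *ᵥ ((Fin.snoc (M.leadingBlock⁻¹ *ᵥ Fin.init a) 0 : Fin (n + 1) → ℝ) +
      (M.lastSchur⁻¹ * (M.lastConj ⬝ᵥ a)) • M.lastConj) = a := by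
    rw [mulVec_add, mulVec_smul, mulVec_lastConj hM.isSymm_real hB, mulVec_snoc hM.isSymm_real,
      mulVec_mulVec, mul_nonsing_inv _ hB]
    ext i
    refine Fin.lastCases ?_ (fun i => ?_) i
    · have h1 : M.lastConj ⬝ᵥ a =
          a (Fin.last n) - M.lastColInit ⬝ᵥ (M.leadingBlock⁻¹ *ᵥ Fin.init a) := by
        rw [dotProduct_mulVec, ← mulVec_transpose, hsymm]
        simp [lastConj, dotProduct, Fin.sum_univ_castSucc, Fin.init, neg_add_eq_sub]
      simp [h1]
      field_simp
      ring
    · simp [Fin.init]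
  conv_lhs => rw [← key]
  rw [mulVec_mulVec, nonsing_inv_mul _ hM.det_pos.ne'.isUnit, one_mulVec]

end Matrix

/-- Theorem 2 of the paper: the inverse-moment-matching coefficient vector
`ξ_N = A_N⁻¹ α^{(N)}` decomposes as `∑_{l=0}^N η_l ĉ_l`, where the `c_l` are built
recursively from the Schur complements `d_l = ν_{2l} − v_{l−1}ᵀ A_{l−1}⁻¹ v_{l−1} > 0`. -/
theorem stmt_13 (N : ℕ) (ν : ℕ → ℝ) (hν0 : ν 0 = 1) (α : ℕ → ℝ) (hα0 : α 0 = 1)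
    (A : (n : ℕ) → Matrix (Fin n) (Fin n) ℝ)
    (hA : ∀ n : ℕ, A n = Matrix.of fun i j : Fin n => ν ((i : ℕ) + (j : ℕ)))
    (hPD : ∀ l : ℕ, l ≤ N → (A (l + 1)).PosDef)
    (v : (l : ℕ) → Fin l → ℝ) (hv : ∀ (l : ℕ) (i : Fin l), v l i = ν (l + (i : ℕ)))
    (d : ℕ → ℝ) (hd : ∀ l : ℕ, d l = ν (2 * l) - v l ⬝ᵥ ((A l)⁻¹ *ᵥ v l))
    (c : (l : ℕ) → Fin (l + 1) → ℝ) (hc0 : c 0 = fun _ => 1)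
    (hc : ∀ l : ℕ, 1 ≤ l →
      c l = (Real.sqrt (d l))⁻¹ • (Fin.snoc (-((A l)⁻¹ *ᵥ v l)) 1 : Fin (l + 1) → ℝ))
    (η : ℕ → ℝ) (hη : ∀ l : ℕ, η l = ∑ i : Fin (l + 1), c l i * α i)
    (chat : (l : ℕ) → Fin (N + 1) → ℝ)
    (hchat : ∀ (l : ℕ) (i : Fin (N + 1)),
      chat l i = if h : (i : ℕ) < l + 1 then c l ⟨i, h⟩ else 0) :
    (∀ l : ℕ, 1 ≤ l → l ≤ N → 0 < d l) ∧
    (A (N + 1))⁻¹ *ᵥ (fun i : Fin (N + 1) => α i)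
      = ∑ l ∈ Finset.range (N + 1), η l • chat l := by
  have hB (l : ℕ) : (A (l + 1)).leadingBlock = A l := by
    ext i j; simp [leadingBlock, hA]
  have hu (l : ℕ) : (A (l + 1)).lastColInit = v l := by
    ext i; simp [lastColInit, hA, hv, add_comm]
  have hS (l : ℕ) : (A (l + 1)).lastSchur = d l := by
    rw [lastSchur, hB, hu, hd, hA (l + 1)]; simp [two_mul]
  have hd_pos (l : ℕ) (hl : l ≤ N) : 0 < d l := hS l ▸ (hPD l hl).lastSchur_pos
  have hc' (l : ℕ) : c l = (Real.sqrt (d l))⁻¹ • (A (l + 1)).lastConj := by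
    rw [lastConj, hB, hu]
    rcases Nat.eq_zero_or_pos l with rfl | hl
    · ext i
      rw [Subsingleton.elim (α := Fin 1) i (Fin.last 0)]
      simp [hc0, hd, hν0]
    · exact hc l hl
  refine ⟨fun l _ hl => hd_pos l hl, ?_⟩
  have main (n : ℕ) (hn : n ≤ N + 1) (i : Fin n) : ((A n)⁻¹ *ᵥ fun j : Fin n => α j) i =
      ∑ l ∈ Finset.range n, η l * if h : (i : ℕ) < l + 1 then c l ⟨i, h⟩ else 0 := by
    induction n with
    | zero => exact i.elim0
    | succ n ih =>
      have hn' : n ≤ N := by omega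
      have hη' : η n = (Real.sqrt (d n))⁻¹ * ((A (n + 1)).lastConj ⬝ᵥ fun j => α j) := by
        rw [hη, hc']; simp [dotProduct, Finset.mul_sum, mul_assoc]
      have hterm : η n * c n i =
          (d n)⁻¹ * ((A (n + 1)).lastConj ⬝ᵥ fun j => α j) * (A (n + 1)).lastConj i := by
        have hsq : (d n)⁻¹ = (Real.sqrt (d n))⁻¹ * (Real.sqrt (d n))⁻¹ := by
          rw [← mul_inv, Real.mul_self_sqrt (hd_pos n hn').le]
        rw [hη', hc', hsq, Pi.smul_apply, smul_eq_mul]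
        ring
      rw [(hPD n hn').inv_mulVec_eq, hS, hB, Finset.sum_range_succ, dif_pos i.isLt, Pi.add_apply,
        Pi.smul_apply, smul_eq_mul, ← hterm]
      congr 1
      refine Fin.lastCases ?_ (fun j => ?_) i
      · rw [Fin.snoc_last]
        refine (Finset.sum_eq_zero fun l hl => ?_).symm
        rw [dif_neg (by simpa using Finset.mem_range.mp hl), mul_zero]
      · rw [Fin.snoc_castSucc]
        exact ih (by omega) j
  ext i
  simp [main (N + 1) le_rfl i, Finset.sum_apply, hchat]
end

section
/- Let σ > 0 and μ ∈ ℝ; set ς = e^{σ²} and φ(q) = ∏_{j=1}^∞ (1 − q^j) for 0 < q < 1. For integers 0 ≤ k ≤ l define c_{l,k} = (−1)^{l+k} e^{kμ} ς^{(k − l − 2k²)/2} · √(∏_{t=0}^{l−1} (1 − ς^{t−l})) / ∏_{t=0, t≠k}^{l} (1 − ς^{−|t−k|}). Then for every N ∈ ℕ and every vector (α_0, …, α_N) with α_k ∈ (0,1] for all k, |∑_{k=0}^N c_{N,k} α_k| ≤ (ς^{−N/2}/φ(ς^{−1})²) · ∑_{k=0}^N e^{σ² k ((μσ^{−2} + 1/2)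 − k)} ≤ (N+1) · ς^{−N/2} · ς^{k₀((μσ^{−2} + 1/2) − k₀)} / φ(ς^{−1})², where k₀ = μσ^{−2}/2 + 1/4. -/
/-- The partial products of the Euler function are bounded below by its value. -/
lemma tprod_one_sub_pow_le_prod_range {q : ℝ} (hq0 : 0 ≤ q) (hq1 : q < 1) (n : ℕ) :
    ∏' j : ℕ, (1 - q ^ (j + 1)) ≤ ∏ j ∈ Finset.range n, (1 - q ^ (j + 1)) := by
  have hs : Summable fun j : ℕ ↦ -q ^ (j + 1) :=
    ((summable_nat_add_iff 1).mpr (summable_geometric_of_lt_one hq0 hq1)).neg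
  have hm : Multipliable fun j : ℕ ↦ 1 - q ^ (j + 1) := by
    simpa [sub_eq_add_neg] using Real.multipliable_one_add_of_summable hs
  have hanti : Antitone fun n ↦ ∏ j ∈ Finset.range n, (1 - q ^ (j + 1)) := by
    refine antitone_nat_of_succ_le fun n ↦ ?_
    rw [Finset.prod_range_succ]
    refine mul_le_of_le_one_right (Finset.prod_nonneg fun j _ ↦ ?_) ?_
    · exact sub_nonneg.mpr (pow_le_one₀ hq0 hq1.le)
    · exact sub_le_self _ (by positivity)
  exact hanti.le_of_tendsto hm.hasProd.tendsto_prod_nat n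

/-- The Euler function is positive on `[0, 1)`. -/
lemma tprod_one_sub_pow_pos {q : ℝ} (hq0 : 0 ≤ q) (hq1 : q < 1) :
    0 < ∏' j : ℕ, (1 - q ^ (j + 1)) := by
  have hs : Summable fun j : ℕ ↦ -q ^ (j + 1) :=
    ((summable_nat_add_iff 1).mpr (summable_geometric_of_lt_one hq0 hq1)).neg
  have hpos (j : ℕ) : 0 < 1 + -q ^ (j + 1) := by
    rw [← sub_eq_add_neg]
    exact sub_pos.mpr (pow_lt_one₀ hq0 hq1 j.succ_ne_zero)
  simp only [sub_eq_add_neg]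
  rw [← Real.rexp_tsum_eq_tprod hpos (Real.summable_log_one_add_of_summable hs)]
  exact Real.exp_pos _

/-- A product over `{0, …, n} \ {k}` of a function of the distance to `k` splits at `k`. -/
lemma prod_range_succ_erase_natAbs_sub {M : Type*} [CommMonoid M] (f : ℕ → M) {n k : ℕ}
    (hk : k ≤ n) :
    ∏ t ∈ (Finset.range (n + 1)).erase k, f ((t : ℤ) - (k : ℤ)).natAbs =
      (∏ j ∈ Finset.range k, f (j + 1)) * ∏ j ∈ Finset.range (n - k), f (j + 1) := by
  have hset : (Finset.range (n + 1)).erase k = Finset.range k ∪ Finset.Ico (k + 1) (n + 1) := by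
    ext t
    simp only [Finset.mem_erase, Finset.mem_range, Finset.mem_union, Finset.mem_Ico]
    omega
  have hdisj : Disjoint (Finset.range k) (Finset.Ico (k + 1) (n + 1)) := by
    rw [Finset.disjoint_left]
    intro t
    simp only [Finset.mem_range, Finset.mem_Ico]
    omega
  rw [hset, Finset.prod_union hdisj, Finset.prod_Ico_eq_prod_range,
    ← Finset.prod_range_reflect (fun j ↦ f (j + 1)) k]
  congr 1
  · refine Finset.prod_congr rfl fun t ht ↦ congrArg f ?_
    have := Finset.mem_range.mp ht
    omega
  · rw [Nat.add_sub_add_right]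
    refine Finset.prod_congr rfl fun t _ ↦ congrArg f ?_
    omega

/-- Inequality (44): bound on the coordinate `η_N = ∑_k c_{N,k} α_k` of the
inverse-moment-matching expansion, where `c_{l,k}` is the closed form (31) with
`ς = exp σ²`, `φ` the Euler function, and the `α_k` lie in `(0,1]`. -/
theorem stmt_19 (σ μ : ℝ) (hσ : 0 < σ) (N : ℕ)
    (ς : ℝ) (hς : ς = Real.exp (σ ^ 2))
    (φ : ℝ) (hφ : φ = ∏' j : ℕ, (1 - ς⁻¹ ^ (j + 1)))
    (c : ℕ → ℕ → ℝ)
    (hc : ∀ l k : ℕ, k ≤ l → c l k =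
      (-1) ^ (l + k) * Real.exp (k * μ) * ς ^ (((k : ℝ) - l - 2 * k ^ 2) / 2) *
        Real.sqrt (∏ t ∈ Finset.range l, (1 - ς ^ ((t : ℤ) - (l : ℤ)))) /
        ∏ t ∈ (Finset.range (l + 1)).erase k, (1 - ς ^ (-(((t : ℤ) - (k : ℤ)).natAbs : ℤ))))
    (α : ℕ → ℝ) (hα : ∀ k : ℕ, k ≤ N → α k ∈ Set.Ioc (0 : ℝ) 1)
    (k₀ : ℝ) (hk₀ : k₀ = μ / σ ^ 2 / 2 + 1 / 4) :
    |∑ k ∈ Finset.range (N + 1), c N k * α k| ≤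
        ς ^ (-(N : ℝ) / 2) / φ ^ 2 *
          ∑ k ∈ Finset.range (N + 1),
            Real.exp (σ ^ 2 * k * ((μ / σ ^ 2 + 1 / 2) - k)) ∧
    ς ^ (-(N : ℝ) / 2) / φ ^ 2 *
        ∑ k ∈ Finset.range (N + 1),
          Real.exp (σ ^ 2 * k * ((μ / σ ^ 2 + 1 / 2) - k))
      ≤ ((N : ℝ) + 1) * ς ^ (-(N : ℝ) / 2) *
          ς ^ (k₀ * ((μ / σ ^ 2 + 1 / 2) - k₀)) / φ ^ 2 := by
  have hσ2 : 0 < σ ^ 2 := by positivity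
  have hς1 : 1 < ς := hς ▸ Real.one_lt_exp_iff.mpr hσ2
  have hς0 : 0 < ς := one_pos.trans hς1
  have hq0 : 0 ≤ ς⁻¹ := (inv_pos.mpr hς0).le
  have hq1 : ς⁻¹ < 1 := inv_lt_one_of_one_lt₀ hς1
  have hφ0 : 0 < φ := hφ ▸ tprod_one_sub_pow_pos hq0 hq1
  have hrpow (x : ℝ) : ς ^ x = Real.exp (σ ^ 2 * x) := by rw [hς, ← Real.exp_mul]
  have hden (k : ℕ) (hk : k ≤ N) : φ ^ 2 ≤
      ∏ t ∈ (Finset.range (N + 1)).erase k,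
        (1 - ς ^ (-(((t : ℤ) - (k : ℤ)).natAbs : ℤ))) := by
    simp only [zpow_neg, zpow_natCast, ← inv_pow]
    rw [prod_range_succ_erase_natAbs_sub (fun m ↦ 1 - ς⁻¹ ^ m) hk, sq]
    have hle (n : ℕ) : φ ≤ ∏ j ∈ Finset.range n, (1 - ς⁻¹ ^ (j + 1)) :=
      hφ ▸ tprod_one_sub_pow_le_prod_range hq0 hq1 n
    exact mul_le_mul (hle k) (hle _) hφ0.le (hφ0.le.trans (hle k))
  have hsqrt : Real.sqrt (∏ t ∈ Finset.range N, (1 - ς ^ ((t : ℤ) - (N : ℤ)))) ≤ 1 := by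
    refine Real.sqrt_le_one.mpr (Finset.prod_le_one (fun t ht ↦ ?_) fun t _ ↦ ?_)
    · have := Finset.mem_range.mp ht
      exact sub_nonneg.mpr (zpow_le_one_of_nonpos₀ hς1.le (by omega))
    · exact sub_le_self _ (zpow_pos hς0 _).le
  have hexp (k : ℕ) : Real.exp (k * μ) * ς ^ (((k : ℝ) - N - 2 * k ^ 2) / 2) =
      ς ^ (-(N : ℝ) / 2) * Real.exp (σ ^ 2 * k * ((μ / σ ^ 2 + 1 / 2) - k)) := by
    rw [hrpow, hrpow, ← Real.exp_add, ← Real.exp_add]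
    congr 1
    field_simp
    ring
  have hterm (k : ℕ) (hk : k ≤ N) : |c N k * α k| ≤ ς ^ (-(N : ℝ) / 2) / φ ^ 2 *
      Real.exp (σ ^ 2 * k * ((μ / σ ^ 2 + 1 / 2) - k)) := by
    obtain ⟨hα0, hα1⟩ := hα k hk
    have hD : 0 < ∏ t ∈ (Finset.range (N + 1)).erase k,
        (1 - ς ^ (-(((t : ℤ) - (k : ℤ)).natAbs : ℤ))) := (pow_pos hφ0 2).trans_le (hden k hk)
    rw [abs_mul, abs_of_pos hα0]
    refine (mul_le_of_le_one_right (abs_nonneg _) hα1).trans ?_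
    rw [hc N k hk, mul_assoc ((-1 : ℝ) ^ (N + k)), hexp, abs_div, abs_mul, abs_mul, abs_neg_one_pow,
      one_mul, abs_of_pos hD, abs_of_nonneg (Real.sqrt_nonneg _), div_mul_eq_mul_div,
      abs_of_pos (by positivity)]
    exact div_le_div₀ (by positivity) (mul_le_of_le_one_right (by positivity) hsqrt)
      (pow_pos hφ0 2) (hden k hk)
  constructor
  · rw [Finset.mul_sum]
    exact (Finset.abs_sum_le_sum_abs _ _).trans (Finset.sum_le_sum fun k hk ↦
      hterm k (Nat.lt_succ_iff.mp (Finset.mem_range.mp hk)))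
  · have hmax (k : ℕ) : Real.exp (σ ^ 2 * k * ((μ / σ ^ 2 + 1 / 2) - k)) ≤
        ς ^ (k₀ * ((μ / σ ^ 2 + 1 / 2) - k₀)) := by
      rw [hrpow, mul_assoc]
      refine Real.exp_le_exp.mpr (mul_le_mul_of_nonneg_left ?_ hσ2.le)
      subst hk₀
      nlinarith [sq_nonneg ((k : ℝ) - (μ / σ ^ 2 / 2 + 1 / 4))]
    calc _ ≤ ς ^ (-(N : ℝ) / 2) / φ ^ 2 *
          ∑ _k ∈ Finset.range (N + 1), ς ^ (k₀ * ((μ / σ ^ 2 + 1 / 2) - k₀)) := by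
          gcongr
          exact hmax _
      _ = _ := by
          rw [Finset.sum_const, Finset.card_range, nsmul_eq_mul]
          push_cast
          ring
end
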